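/- arXiv:1801.01826 — 11 statements merged into one kernel-verified Lean document; each statement's English description precedes it below -/
import Mathlib

section
/- Let A and B be nonempty compact subsets of the Hilbert cube Q = [0,1]^ℕ and let q : A → B be a continuous map. Then there exists a closed set F ⊆ Q × 2^ℕ (where 2^ℕ is the Cantor space) such that the family of sections {F^b : b ∈ 2^ℕ} is equivalent to the family of fibers {q⁻¹(b) : b ∈ B}, i.e. every section F^b is homeomorphic to some fiber q⁻¹(b′) and every fiber q⁻¹(b′) is homeomorphic to some section F^b. -/
/-- The Hilbert cube `[0,1]^ℕ`. -/
abbrev HilbertCube : Type := ℕ → unitInterval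

/-- Every compact composition (a continuous map `q : A → B` between nonempty compact
subsets of the Hilbert cube) admits an equivalent closed set `F ⊆ Q × 2^ℕ`:
the sections of `F` are, up to homeomorphism, exactly the fibers of `q`. -/
theorem compact_composition_has_closed_rectangular_form
    (A B : Set HilbertCube)
    (hA : IsCompact A) (hB : IsCompact B)
    (hAne : A.Nonempty) (hBne : B.Nonempty)
    (q : A → B) (hq : Continuous q) :
    ∃ F : Set (HilbertCube × (ℕ → Bool)),
      IsClosed F ∧
      (∀ b : ℕ → Bool, ∃ b' : B,
        Nonempty (↥{a : HilbertCube | (a, b) ∈ F} ≃ₜ ↥(q ⁻¹' {b'}))) ∧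
      (∀ b' : B, ∃ b : ℕ → Bool,
        Nonempty (↥{a : HilbertCube | (a, b) ∈ F} ≃ₜ ↥(q ⁻¹' {b'}))) := by
  have : CompactSpace B := isCompact_iff_compactSpace.mp hB
  have : Nonempty B := hBne.to_subtype
  let : MetricSpace B := TopologicalSpace.metrizableSpaceMetric B
  obtain ⟨g, hg, hg_surj⟩ := exists_nat_bool_continuous_surjective_of_compact B
  have section_homeo (c : ℕ → Bool) :
      Nonempty (↥{a : HilbertCube | (a, c) ∈
        Prod.map Subtype.val id '' {p : A × (ℕ → Bool) | q p.1 = g p.2}} ≃ₜ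
          ↥(q ⁻¹' {g c})) := by
    have h : {a : HilbertCube | (a, c) ∈
        Prod.map Subtype.val id '' {p : A × (ℕ → Bool) | q p.1 = g p.2}} =
          Subtype.val '' (q ⁻¹' {g c}) := by
      ext a
      simp
    rw [h]
    exact ⟨(Topology.IsEmbedding.subtypeVal.homeomorphImage _).symm⟩
  refine ⟨Prod.map Subtype.val id '' {p : A × (ℕ → Bool) | q p.1 = g p.2}, ?_,
    fun c => ⟨g c, section_homeo c⟩, fun b' => ?_⟩
  · exact (hA.isClosed.isClosedEmbedding_subtypeVal.prodMap .id).isClosedMap _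
      (isClosed_eq (hq.comp continuous_fst) (hg.comp continuous_snd))
  · obtain ⟨c, rfl⟩ := hg_surj b'
    exact ⟨c, section_homeo c⟩
end

section
/- Let A and B be nonempty closed subsets of ℝ^ℕ (with the product topology) and let q : A → B be a continuous map. Then there exists a Gδ set F ⊆ [0,1]^ℕ × ℕ^ℕ (where ℕ^ℕ is the Baire space) such that the family of sections {F^b : b ∈ ℕ^ℕ} is equivalent to the family of fibers {q⁻¹(b) : b ∈ B}, i.e. every section F^b is homeomorphic to some fiber of q and every fiber of q is homeomorphic to some section F^b. -/
open Set Topology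

/-- An inducing map with Gδ range sends closed sets to Gδ sets. -/
theorem Topology.IsInducing.isGδ_image_of_isClosed {X Y : Type*} [TopologicalSpace X]
    [TopologicalSpace Y] [PerfectlyNormalSpace Y] {f : X → Y} (hf : IsInducing f)
    (hrange : IsGδ (range f)) {s : Set X} (hs : IsClosed s) : IsGδ (f '' s) := by
  obtain ⟨t, ht, rfl⟩ := hf.isClosed_iff.1 hs
  rw [image_preimage_eq_inter_range]
  exact ht.isGδ.inter hrange

/-- The coordinatewise sigmoid embedding of `ℝ^ℕ` into the Hilbert cube. -/
noncomputable def hilbertCubeEmbedding : (ℕ → ℝ) → (ℕ → unitInterval) :=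
  Pi.map fun _ => unitInterval.sigmoid

theorem isEmbedding_hilbertCubeEmbedding : IsEmbedding hilbertCubeEmbedding :=
  IsEmbedding.piMap fun _ => isEmbedding_sigmoid

theorem isGδ_range_hilbertCubeEmbedding : IsGδ (range hilbertCubeEmbedding) := by
  rw [hilbertCubeEmbedding, range_piMap, pi_def]
  simp only [mem_univ, iInter_true, unitInterval.range_sigmoid]
  exact .iInter_of_isOpen fun i => isOpen_Ioo.preimage (continuous_apply i)

/-- The image of a set under an embedding of the ambient space is homeomorphic to the set. -/
theorem Topology.IsEmbedding.nonempty_homeomorph_image_subtype {X Y : Type*} [TopologicalSpace X]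
    [TopologicalSpace Y] {e : X → Y} (he : IsEmbedding e) {A : Set X} (s : Set A) :
    Nonempty (↥(e '' (Subtype.val '' s)) ≃ₜ ↥s) :=
  ⟨((IsEmbedding.subtypeVal.homeomorphImage s).trans
    (he.homeomorphImage (Subtype.val '' s))).symm⟩

/-- Every Polish composition (a continuous map `q : A → B` between nonempty closed
subsets of `ℝ^ℕ`) admits an equivalent Gδ set `F ⊆ [0,1]^ℕ × ℕ^ℕ`:
the sections of `F` are, up to homeomorphism, exactly the fibers of `q`. -/
theorem polish_composition_has_Gdelta_rectangular_form
    (A B : Set (ℕ → ℝ))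
    (hA : IsClosed A) (hB : IsClosed B)
    (hAne : A.Nonempty) (hBne : B.Nonempty)
    (q : A → B) (hq : Continuous q) :
    ∃ F : Set ((ℕ → unitInterval) × (ℕ → ℕ)),
      IsGδ F ∧
      (∀ b : ℕ → ℕ, ∃ b' : B,
        Nonempty (↥{a : ℕ → unitInterval | (a, b) ∈ F} ≃ₜ ↥(q ⁻¹' {b'}))) ∧
      (∀ b' : B, ∃ b : ℕ → ℕ,
        Nonempty (↥{a : ℕ → unitInterval | (a, b) ∈ F} ≃ₜ ↥(q ⁻¹' {b'}))) := by
  have : Nonempty B := hBne.to_subtype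
  have : PolishSpace B := hB.polishSpace
  obtain ⟨p, hp, hsurj⟩ := PolishSpace.exists_nat_nat_continuous_surjective B
  let G : Set ((ℕ → ℝ) × (ℕ → ℕ)) :=
    Prod.map Subtype.val id '' {x : A × (ℕ → ℕ) | q x.1 = p x.2}
  have hG : IsClosed G :=
    (hA.isClosedEmbedding_subtypeVal.prodMap .id).isClosedMap _
      (isClosed_eq (hq.comp continuous_fst) (hp.comp continuous_snd))
  let E : (ℕ → ℝ) × (ℕ → ℕ) → (ℕ → unitInterval) × (ℕ → ℕ) :=
    Prod.map hilbertCubeEmbedding id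
  have hE : IsEmbedding E := isEmbedding_hilbertCubeEmbedding.prodMap .id
  have hErange : IsGδ (range E) := by
    rw [range_prodMap, range_id, prod_univ]
    exact isGδ_range_hilbertCubeEmbedding.preimage continuous_fst
  have hsection (b : ℕ → ℕ) : {a | (a, b) ∈ E '' G} =
      hilbertCubeEmbedding '' (Subtype.val '' (q ⁻¹' {p b})) := by
    ext a
    simp [E, G]
  have hfiber (b : ℕ → ℕ) :
      Nonempty (↥{a | (a, b) ∈ E '' G} ≃ₜ ↥(q ⁻¹' {p b})) := by
    rw [hsection]
    exact isEmbedding_hilbertCubeEmbedding.nonempty_homeomorph_image_subtype _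
  refine ⟨E '' G, hE.isInducing.isGδ_image_of_isClosed hErange hG,
    fun b => ⟨p b, hfiber b⟩, fun b' => ?_⟩
  obtain ⟨b, rfl⟩ := hsurj b'
  exact ⟨b, hfiber b⟩
end

section
/- (i) Let A and B be compact subsets of the Hilbert cube Q = [0,1]^ℕ with B nonempty, and let q : A → B be a continuous surjection all of whose fibers q⁻¹(b) are connected and nonempty. Then there exists a compact set K ⊆ Q whose family of connected components is equivalent to the family {q⁻¹(b) : b ∈ B}. (ii) Conversely, for every nonempty compact set K ⊆ Q there exist compact sets A, B ⊆ Q and a continuous surjection q : A → B such that the family {q⁻¹(b) : b ∈ B} is equivalent to the family of connected components of K. -/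
open TopologicalSpace Topology

/-- A compact second countable space has only countably many clopen subsets. -/
theorem TopologicalSpace.Clopens.countable_of_secondCountable (X : Type*) [TopologicalSpace X]
    [CompactSpace X] [SecondCountableTopology X] : Countable (Clopens X) := by
  have h (s : Clopens X) : ∃ t : Finset (countableBasis X), s.1 = (SetLike.coe t).sUnion :=
    eq_sUnion_finset_of_isTopologicalBasis_of_isCompact_open _
      (isBasis_countableBasis X) s.1 s.2.1.isCompact s.2.2
  choose f hf using h
  refine Function.Injective.countable (f := f) fun s t hst ↦ ?_
  ext1
  change s.carrier = t.carrier
  rw [hf s, hf t, hst]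

/-- The space of components of a compact Hausdorff second countable space is second countable. -/
theorem ConnectedComponents.secondCountableTopology (X : Type*) [TopologicalSpace X]
    [CompactSpace X] [T2Space X] [SecondCountableTopology X] :
    SecondCountableTopology (ConnectedComponents X) := by
  rw [← Clopens.countable_iff_secondCountable]
  have := Clopens.countable_of_secondCountable X
  let f : Clopens (ConnectedComponents X) → Clopens X := fun s ↦
    ⟨ConnectedComponents.mk ⁻¹' (s : Set (ConnectedComponents X)),
      s.isClopen.preimage ConnectedComponents.continuous_coe⟩
  refine Function.Injective.countable (f := f) fun s t hst ↦ ?_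
  exact SetLike.coe_injective
    (ConnectedComponents.surjective_coe.preimage_injective (congrArg SetLike.coe hst))

/-- Every compact Hausdorff second countable space embeds into the Hilbert cube. -/
theorem exists_isEmbedding_hilbertCube (X : Type*) [TopologicalSpace X]
    [CompactSpace X] [T2Space X] [SecondCountableTopology X] :
    ∃ F : X → ℕ → unitInterval, IsEmbedding F := by
  let := metrizableSpaceMetric X
  exact Metric.PiNatEmbed.exists_embedding_to_hilbert_cube

/-- Homeomorphisms carry components onto components. -/
theorem Homeomorph.image_connectedComponent {X Y : Type*} [TopologicalSpace X]
    [TopologicalSpace Y] (e : X ≃ₜ Y) (x : X) :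
    e '' connectedComponent x = connectedComponent (e x) := by
  refine (e.continuous.image_connectedComponent_subset x).antisymm fun y hy ↦ ?_
  have h := e.symm.continuous.image_connectedComponent_subset (e x) ⟨y, hy, rfl⟩
  rw [e.symm_apply_apply] at h
  exact ⟨e.symm y, h, e.apply_symm_apply y⟩

/-- The connected fibers of a map to a totally disconnected space are the components of its
domain. -/
theorem Continuous.connectedComponent_eq_preimage_singleton {X Y : Type*} [TopologicalSpace X]
    [TopologicalSpace Y] [TotallyDisconnectedSpace Y] {f : X → Y} (hf : Continuous f) (x : X)
    (hx : IsPreconnected (f ⁻¹' {f x})) : connectedComponent x = f ⁻¹' {f x} := by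
  refine Set.Subset.antisymm (fun y hy ↦ ?_) (hx.subset_connectedComponent rfl)
  have h := hf.image_connectedComponent_subset x ⟨y, hy, rfl⟩
  rwa [connectedComponent_eq_singleton] at h

/-- The fiber over `c` of a base change along `f` is the fiber over `f c` of the original map. -/
def Function.Pullback.fiberHomeomorph {C A B : Type*} [TopologicalSpace C] [TopologicalSpace A]
    (f : C → B) (q : A → B) (c : C) :
    ↥((fun z : Function.Pullback f q ↦ z.fst) ⁻¹' {c}) ≃ₜ ↥(q ⁻¹' {f c}) where
  toFun z := ⟨z.1.snd, by
    have h : f z.1.fst = q z.1.snd := z.1.2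
    rw [show z.1.fst = c from z.2] at h
    exact h.symm⟩
  invFun a := ⟨⟨(c, a.1), Eq.symm a.2⟩, rfl⟩
  left_inv z := Subtype.ext (Subtype.ext (Prod.ext (Eq.symm z.2) rfl))
  right_inv _ := rfl
  continuous_toFun := by
    exact (continuous_snd.comp (continuous_subtype_val.comp continuous_subtype_val)).subtype_mk _
  continuous_invFun := by
    exact ((continuous_const.prodMk continuous_subtype_val).subtype_mk _).subtype_mk _

/-- The fibers of a continuous surjection with connected fibers between compact metrizable spaces
are, up to homeomorphism, the components of a compact subset of the Hilbert cube. -/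
theorem exists_isCompact_connectedComponent_homeomorph_fiber {A B : Type*} [TopologicalSpace A]
    [TopologicalSpace B] [CompactSpace A] [T2Space A] [SecondCountableTopology A] [CompactSpace B]
    [MetrizableSpace B] [Nonempty B] (q : A → B) (hq : Continuous q)
    (hfib : ∀ b, IsPreconnected (q ⁻¹' {b})) (hsurj : Function.Surjective q) :
    ∃ K : Set (ℕ → unitInterval), IsCompact K ∧
      (∀ x : K, ∃ b : B, Nonempty (↥(connectedComponent x) ≃ₜ ↥(q ⁻¹' {b}))) ∧
      (∀ b : B, ∃ x : K, Nonempty (↥(connectedComponent x) ≃ₜ ↥(q ⁻¹' {b}))) := by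
  let := metrizableSpaceMetric B
  obtain ⟨f, hf, hfs⟩ := exists_nat_bool_continuous_surjective_of_compact B
  let P := Function.Pullback f q
  have hclosed : IsClosed {z : (ℕ → Bool) × A | f z.1 = q z.2} :=
    isClosed_eq (hf.comp continuous_fst) (hq.comp continuous_snd)
  have : CompactSpace P := isCompact_iff_compactSpace.mp hclosed.isCompact
  have : SecondCountableTopology P :=
    Subtype.secondCountableTopology {z : (ℕ → Bool) × A | f z.1 = q z.2}
  obtain ⟨F, hF⟩ := exists_isEmbedding_hilbertCube P
  let e : P ≃ₜ Set.range F := hF.toHomeomorph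
  have hcomp (z : P) :
      Nonempty (↥(connectedComponent (e z)) ≃ₜ ↥(q ⁻¹' {f z.fst})) := by
    let g := Function.Pullback.fiberHomeomorph f q z.fst
    have hpre : IsPreconnected ((fun w : P ↦ w.fst) ⁻¹' {z.fst}) := by
      have := isPreconnected_iff_preconnectedSpace.mp (hfib (f z.fst))
      exact isPreconnected_iff_preconnectedSpace.mpr
        (g.symm.surjective.denseRange.preconnectedSpace g.symm.continuous)
    have hz := (continuous_fst.comp continuous_subtype_val :
      Continuous fun w : P ↦ w.fst).connectedComponent_eq_preimage_singleton z hpre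
    exact ⟨(Homeomorph.setCongr (e.image_connectedComponent z).symm).trans
      ((e.image _).symm.trans ((Homeomorph.setCongr hz).trans g))⟩
  refine ⟨Set.range F, isCompact_range hF.continuous, fun x ↦ ?_, fun b ↦ ?_⟩
  · obtain ⟨z, rfl⟩ := e.surjective x
    exact ⟨_, hcomp z⟩
  · obtain ⟨c, rfl⟩ := hfs b
    obtain ⟨a, ha⟩ := hsurj (f c)
    exact ⟨e ⟨(c, a), ha.symm⟩, hcomp _⟩

/-- The components of a compact metrizable space are the fibers of a continuous surjection onto
a compact subset of the Hilbert cube. -/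
theorem exists_continuous_surjective_fiber_eq_connectedComponent (X : Type*) [TopologicalSpace X]
    [CompactSpace X] [T2Space X] [SecondCountableTopology X] :
    ∃ B : Set (ℕ → unitInterval), IsCompact B ∧ ∃ q : X → B, Continuous q ∧
      Function.Surjective q ∧ ∀ x, q ⁻¹' {q x} = connectedComponent x := by
  have := ConnectedComponents.secondCountableTopology X
  obtain ⟨F, hF⟩ := exists_isEmbedding_hilbertCube (ConnectedComponents X)
  let e : ConnectedComponents X ≃ₜ Set.range F := hF.toHomeomorph
  refine ⟨Set.range F, isCompact_range hF.continuous, e ∘ ConnectedComponents.mk,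
    e.continuous.comp ConnectedComponents.continuous_coe,
    e.surjective.comp ConnectedComponents.surjective_coe, fun x ↦ ?_⟩
  ext y
  simp [← connectedComponent_eq_iff_mem, eq_comm]

/-- A class of nonempty metrizable continua is compactifiable iff there is a metrizable
compactum whose set of connected components is equivalent to the class.
(i) Given a compact composition with connected nonempty fibers, there is a compact set
`K ⊆ Q` whose components are, up to homeomorphism, exactly the fibers.
(ii) Conversely, the components of any nonempty compact `K ⊆ Q` arise as the fibers of
a continuous surjection between compact subsets of `Q`. -/
theorem components_iff_compact_composition :
    (∀ (A B : Set (ℕ → unitInterval)), IsCompact A → IsCompact B → B.Nonempty →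
      ∀ q : A → B, Continuous q → Function.Surjective q →
      (∀ b : B, IsConnected (q ⁻¹' {b})) →
      ∃ K : Set (ℕ → unitInterval), IsCompact K ∧
        (∀ x : K, ∃ b : B, Nonempty (↥(connectedComponent x) ≃ₜ ↥(q ⁻¹' {b}))) ∧
        (∀ b : B, ∃ x : K, Nonempty (↥(connectedComponent x) ≃ₜ ↥(q ⁻¹' {b})))) ∧
    (∀ K : Set (ℕ → unitInterval), IsCompact K → K.Nonempty →
      ∃ A B : Set (ℕ → unitInterval), IsCompact A ∧ IsCompact B ∧
      ∃ q : A → B, Continuous q ∧ Function.Surjective q ∧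
        (∀ b : B, ∃ x : K, Nonempty (↥(q ⁻¹' {b}) ≃ₜ ↥(connectedComponent x))) ∧
        (∀ x : K, ∃ b : B, Nonempty (↥(q ⁻¹' {b}) ≃ₜ ↥(connectedComponent x)))) := by
  refine ⟨fun A B hA hB hBne q hq hs hfib ↦ ?_, fun K hK _ ↦ ?_⟩
  · have := isCompact_iff_compactSpace.mp hA
    have := isCompact_iff_compactSpace.mp hB
    have := hBne.to_subtype
    exact exists_isCompact_connectedComponent_homeomorph_fiber q hq
      (fun b ↦ (hfib b).isPreconnected) hs
  · have := isCompact_iff_compactSpace.mp hK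
    obtain ⟨B, hB, q, hq, hs, hfib⟩ :=
      exists_continuous_surjective_fiber_eq_connectedComponent K
    refine ⟨K, B, hK, hB, q, hq, hs, fun b ↦ ?_,
      fun x ↦ ⟨q x, ⟨Homeomorph.setCongr (hfib x)⟩⟩⟩
    obtain ⟨x, rfl⟩ := hs b
    exact ⟨x, ⟨Homeomorph.setCongr (hfib x)⟩⟩
end

section
/- For each n ∈ ℕ let A_n and B_n be compact subsets of the Hilbert cube Q = [0,1]^ℕ and let q_n : A_n → B_n be a continuous map. Then there exist compact sets A, B ⊆ Q and a continuous map q : A → B such that the family of fibers {q⁻¹(b) : b ∈ B} is equivalent to the union ⋃_{n ∈ ℕ} {q_n⁻¹(b) : b ∈ B_n}, i.e. every fiber of q is homeomorphic to a fiber of some q_n and every fiber of every q_n is homeomorphic to a fiber of q. -/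
open Set Function Topology Filter

/-- Copies of compact sets placed along the different axes of a power of `X` through the
constant function `c` have compact union, since they accumulate only at this constant function. -/
theorem isCompact_iUnion_image_update {ι X : Type*} [DecidableEq ι] [TopologicalSpace X]
    {C : ι → Set X} (hC : ∀ i, IsCompact (C i)) {c : X} {m : ι} (hc : c ∈ C m) :
    IsCompact (⋃ i, update (fun _ : ι => c) i '' C i) := by
  rw [isCompact_iff_ultrafilter_le_nhds']
  intro f hf
  by_cases h : ∃ i, update (fun _ : ι => c) i '' C i ∈ f
  · obtain ⟨i, hi⟩ := h
    have hK : IsCompact (update (fun _ : ι => c) i '' C i) :=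
      (hC i).image (continuous_const.update i continuous_id)
    obtain ⟨x, hx, hfx⟩ := isCompact_iff_ultrafilter_le_nhds'.1 hK f hi
    exact ⟨x, mem_iUnion.2 ⟨i, hx⟩, hfx⟩
  · push Not at h
    refine ⟨fun _ => c, mem_iUnion.2 ⟨m, c, hc, update_eq_self m _⟩, ?_⟩
    rw [nhds_pi, le_pi]
    intro k
    refine tendsto_const_nhds.congr' ?_
    filter_upwards [hf, Ultrafilter.compl_mem_iff_notMem.2 (h k)] with x hx hxk
    obtain ⟨i, hi⟩ := mem_iUnion.1 hx
    have hik : k ≠ i := by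
      rintro rfl
      exact hxk hi
    obtain ⟨y, -, rfl⟩ := hi
    simp [hik]

/-- A continuous map between compact metrizable spaces has a copy between compact subsets
of the Hilbert cube. -/
theorem exists_hilbertCube_fibers_homeomorph {X Y : Type*}
    [TopologicalSpace X] [CompactSpace X] [TopologicalSpace.MetrizableSpace X]
    [TopologicalSpace Y] [CompactSpace Y] [TopologicalSpace.MetrizableSpace Y]
    {p : X → Y} (hp : Continuous p) :
    ∃ A B : Set (ℕ → unitInterval), IsCompact A ∧ IsCompact B ∧
      ∃ q : A → B, Continuous q ∧ ∃ e : Y ≃ B,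
        ∀ y, Nonempty (↥(q ⁻¹' {e y}) ≃ₜ ↥(p ⁻¹' {y})) := by
  let _ := TopologicalSpace.metrizableSpaceMetric X
  let _ := TopologicalSpace.metrizableSpaceMetric Y
  obtain ⟨F, hF⟩ := Metric.PiNatEmbed.exists_embedding_to_hilbert_cube (X := X)
  obtain ⟨G, hG⟩ := Metric.PiNatEmbed.exists_embedding_to_hilbert_cube (X := Y)
  refine ⟨range F, range G, isCompact_range hF.continuous, isCompact_range hG.continuous,
    hG.toHomeomorph ∘ p ∘ hF.toHomeomorph.symm, ?_, hG.toHomeomorph.toEquiv, fun y => ?_⟩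
  · exact hG.toHomeomorph.continuous.comp (hp.comp hF.toHomeomorph.symm.continuous)
  · exact ⟨hF.toHomeomorph.symm.subtype fun a => by simp⟩

/-- Countably many maps `qₙ : Aₙ → Bₙ` can be glued together without creating new fibers by letting
the copies of `Aₙ` converge to a point `a` of some `Aₘ` and the copies of `Bₙ` to `qₘ a`. -/
theorem exists_compact_composition_of_nonempty
    {A B : ℕ → Set (ℕ → unitInterval)}
    (hA : ∀ n, IsCompact (A n)) (hB : ∀ n, IsCompact (B n))
    {q : ∀ n, (A n) → (B n)} (hq : ∀ n, Continuous (q n)) {m : ℕ} (a : A m) :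
    ∃ A' B' : Set (ℕ → unitInterval), IsCompact A' ∧ IsCompact B' ∧
      ∃ q' : A' → B', Continuous q' ∧
        (∀ b : B', ∃ n, ∃ b' : B n,
          Nonempty (↥(q' ⁻¹' {b}) ≃ₜ ↥((q n) ⁻¹' {b'}))) ∧
        (∀ n, ∀ b' : B n, ∃ b : B',
          Nonempty (↥(q' ⁻¹' {b}) ≃ₜ ↥((q n) ⁻¹' {b'}))) := by
  have hcA (n) : CompactSpace (A n) := isCompact_iff_compactSpace.1 (hA n)
  have hcB (n) : CompactSpace (B n) := isCompact_iff_compactSpace.1 (hB n)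
  let tag : ℕ → unitInterval := fun n => if n = m then 0 else 1
  let φ : ∀ n, A n → (ℕ → unitInterval) × unitInterval × (ℕ → unitInterval) :=
    fun n x => (x, tag n, q n x)
  let ψ : ∀ n, B n → unitInterval × (ℕ → unitInterval) := fun n y => (tag n, y)
  have hφ (n) : Continuous (φ n) := by fun_prop
  have hψ (n) : Continuous (ψ n) := by fun_prop
  let f : ∀ n, A n → ℕ → (ℕ → unitInterval) × unitInterval × (ℕ → unitInterval) :=
    fun n x => update (fun _ => φ m a) n (φ n x)
  let g : ∀ n, B n → ℕ → unitInterval × (ℕ → unitInterval) :=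
    fun n y => update (fun _ => ψ m (q m a)) n (ψ n y)
  have hf (n) : Continuous (f n) := continuous_const.update n (hφ n)
  have f_inj (n) : Injective (f n) := fun x y h =>
    Subtype.ext (congrArg Prod.fst (update_injective _ n h))
  have g_inj (n) : Injective (g n) := fun x y h =>
    Subtype.ext (congrArg Prod.snd (update_injective _ n h))
  have snd_f (n) (x : A n) : (fun k => (f n x k).2) = g n (q n x) := by
    funext k
    by_cases hk : k = n
    · subst hk; simp [f, g, φ, ψ]
    · simp [f, g, φ, ψ, hk]
  have tag_g (n) (y : B n) (k) (hk : k ≠ m) : (g n y k).1 = if k = n then 1 else 0 := by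
    by_cases hkn : k = n
    · subst hkn; simp [g, ψ, tag, hk]
    · simp [g, ψ, tag, hkn]
  have g_index {n k} {y : B n} {z : B k} (h : g n y = g k z) : n = k := by
    by_contra hnk
    by_cases hn : n = m
    · have hk : k ≠ m := fun hk => hnk (hn.trans hk.symm)
      have := tag_g k z k hk
      rw [← h, tag_g n y k hk] at this
      simp [Ne.symm hnk] at this
    · have := tag_g n y n hn
      rw [h, tag_g k z n hn] at this
      simp [hnk] at this
  let X := ⋃ n, range (f n)
  let Y := ⋃ n, range (g n)
  have hX : IsCompact X := by
    have := isCompact_iUnion_image_update (fun n => isCompact_range (hφ n))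
      (mem_range_self (f := φ m) a)
    simp only [← range_comp] at this
    exact this
  have hY : IsCompact Y := by
    have := isCompact_iUnion_image_update (fun n => isCompact_range (hψ n))
      (mem_range_self (f := ψ m) (q m a))
    simp only [← range_comp] at this
    exact this
  have := isCompact_iff_compactSpace.1 hX
  have := isCompact_iff_compactSpace.1 hY
  have hmaps : MapsTo (fun (x : ℕ → (ℕ → unitInterval) × unitInterval × (ℕ → unitInterval)) k =>
      (x k).2) X Y := by
    intro x hx
    obtain ⟨n, x, rfl⟩ := mem_iUnion.1 hx
    exact mem_iUnion.2 ⟨n, q n x, (snd_f n x).symm⟩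
  let gY (n) (y : B n) : Y := ⟨g n y, mem_iUnion.2 ⟨n, y, rfl⟩⟩
  have fiber (n) (y : B n) : Nonempty (↥(q n ⁻¹' {y}) ≃ₜ ↥(hmaps.restrict ⁻¹' {gY n y})) := by
    have : CompactSpace ↥(q n ⁻¹' {y}) :=
      isCompact_iff_compactSpace.1 (isClosed_singleton.preimage (hq n)).isCompact
    let h : ↥(q n ⁻¹' {y}) → ↥(hmaps.restrict ⁻¹' {gY n y}) := fun x =>
      ⟨⟨f n x, mem_iUnion.2 ⟨n, x, rfl⟩⟩,
        Subtype.ext ((snd_f n x).trans (congrArg (g n) x.2))⟩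
    have hh : Continuous h :=
      (((hf n).comp continuous_subtype_val).subtype_mk _).subtype_mk _
    refine ⟨(isHomeomorph_iff_continuous_bijective.2 ⟨hh, ?_, ?_⟩).homeomorph⟩
    · intro x x' hx
      exact Subtype.ext (f_inj n (congrArg (fun z => z.1.1) hx))
    · rintro ⟨⟨x, hx⟩, hxy⟩
      obtain ⟨k, x, rfl⟩ := mem_iUnion.1 hx
      have hg : g k (q k x) = g n y := (snd_f k x).symm.trans (congrArg Subtype.val hxy)
      obtain rfl := g_index hg
      exact ⟨⟨x, g_inj k hg⟩, rfl⟩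
  have hp : Continuous hmaps.restrict :=
    Continuous.restrict hmaps (by fun_prop)
  obtain ⟨A', B', hA', hB', q', hq', e, he⟩ := exists_hilbertCube_fibers_homeomorph hp
  have fiber' (n) (y : B n) : Nonempty (↥(q' ⁻¹' {e (gY n y)}) ≃ₜ ↥(q n ⁻¹' {y})) :=
    (he (gY n y)).map2 (fun h k => h.trans k.symm) (fiber n y)
  refine ⟨A', B', hA', hB', q', hq', fun b => ?_, fun n y => ⟨e (gY n y), fiber' n y⟩⟩
  obtain ⟨⟨z, hz⟩, rfl⟩ := e.surjective b
  obtain ⟨n, y, rfl⟩ := mem_iUnion.1 hz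
  exact ⟨n, y, fiber' n y⟩


/-- A countable union of compactifiable classes is compactifiable: given countably many
compact compositions `qₙ : Aₙ → Bₙ` between compact subsets of the Hilbert cube, there
is a single compact composition `q : A → B` whose fibers are, up to homeomorphism,
exactly the fibers of all the maps `qₙ`. -/
theorem countable_union_of_compact_compositions
    (A B : ℕ → Set (ℕ → unitInterval))
    (hA : ∀ n, IsCompact (A n)) (hB : ∀ n, IsCompact (B n))
    (q : ∀ n, (A n) → (B n)) (hq : ∀ n, Continuous (q n)) :
    ∃ A' B' : Set (ℕ → unitInterval), IsCompact A' ∧ IsCompact B' ∧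
      ∃ q' : A' → B', Continuous q' ∧
        (∀ b : B', ∃ n, ∃ b' : B n,
          Nonempty (↥(q' ⁻¹' {b}) ≃ₜ ↥((q n) ⁻¹' {b'}))) ∧
        (∀ n, ∀ b' : B n, ∃ b : B',
          Nonempty (↥(q' ⁻¹' {b}) ≃ₜ ↥((q n) ⁻¹' {b'}))) := by
  by_cases h : ∃ m, Nonempty (A m)
  · obtain ⟨m, ⟨a⟩⟩ := h
    exact exists_compact_composition_of_nonempty hA hB hq a
  have hempty (n) : IsEmpty (A n) := not_nonempty_iff.1 fun hn => h ⟨n, hn⟩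
  by_cases h' : ∃ m, Nonempty (B m)
  · obtain ⟨m, hm⟩ := h'
    refine ⟨A m, B m, hA m, hB m, q m, hq m, fun b => ⟨m, b, ⟨.refl _⟩⟩, fun n b' => ?_⟩
    exact ⟨hm.some, ⟨.empty⟩⟩
  · refine ⟨∅, ∅, isCompact_empty, isCompact_empty, id, continuous_id, fun b => b.2.elim,
      fun n b' => (h' ⟨n, ⟨b'⟩⟩).elim⟩
end

section
/- Let X be a Polish space such that X × ℕ^ℕ admits a topological embedding into X, and let K(X) be the hyperspace of nonempty compact subsets of X with the Hausdorff metric (a Polish space). Then every analytic family F ⊆ K(X) is equivalent to some Gδ family G ⊆ K(X), i.e. there is a Gδ set G ⊆ K(X) such that every member of F is homeomorphic to a member of G and every member of G is homeomorphic to a member of F. -/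
open TopologicalSpace

/-- A completely metrizable subspace of a perfectly normal Hausdorff space is a Gδ set. -/
theorem Topology.IsEmbedding.isGδ_range {α β : Type*} [TopologicalSpace α]
    [IsCompletelyMetrizableSpace α] [TopologicalSpace β] [T2Space β] [PerfectlyNormalSpace β]
    {f : α → β} (hf : Topology.IsEmbedding f) : IsGδ (Set.range f) := by
  let := upgradeIsCompletelyMetrizable α
  let U : ℕ → Set β := fun n =>
    ⋃₀ {V | IsOpen V ∧ ∀ a ∈ f ⁻¹' V, ∀ b ∈ f ⁻¹' V, dist a b < 1 / ((n : ℝ) + 1)}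
  suffices h : Set.range f = closure (Set.range f) ∩ ⋂ n, U n by
    rw [h]
    exact isClosed_closure.isGδ.inter
      (.iInter_of_isOpen fun n => isOpen_sUnion fun V hV => hV.1)
  apply Set.Subset.antisymm
  · rintro _ ⟨a, rfl⟩
    refine ⟨subset_closure ⟨a, rfl⟩, Set.mem_iInter.2 fun n => ?_⟩
    have hn : (0 : ℝ) < 1 / ((n : ℝ) + 1) := by positivity
    obtain ⟨V, hV, hVa⟩ := hf.isInducing.isOpen_iff.1
      (Metric.isOpen_ball (x := a) (ε := 1 / ((n : ℝ) + 1) / 2))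
    refine ⟨V, ⟨hV, fun b hb c hc => ?_⟩, ?_⟩
    · rw [hVa, Metric.mem_ball] at hb hc
      linarith [dist_triangle_right b c a]
    · have ha : a ∈ f ⁻¹' V := hVa ▸ Metric.mem_ball_self (half_pos hn)
      exact ha
  · rintro y ⟨hy, hyU⟩
    have : (Filter.comap f (nhds y)).NeBot :=
      Filter.comap_neBot_iff.2 fun t ht =>
        let ⟨_, hz, a, ha⟩ := mem_closure_iff_nhds.1 hy t ht
        ⟨a, ha ▸ hz⟩
    have hC : Cauchy (Filter.comap f (nhds y)) := by
      refine Metric.cauchy_iff.2 ⟨this, fun ε hε => ?_⟩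
      obtain ⟨n, hn⟩ := exists_nat_one_div_lt hε
      obtain ⟨V, ⟨hV, hVd⟩, hyV⟩ := Set.mem_iInter.1 hyU n
      exact ⟨f ⁻¹' V, Filter.preimage_mem_comap (hV.mem_nhds hyV),
        fun a ha b hb => (hVd a ha b hb).trans hn⟩
    obtain ⟨a, ha⟩ := CompleteSpace.complete hC
    exact ⟨a, tendsto_nhds_unique ((hf.continuous.tendsto a).mono_left ha)
      Filter.tendsto_comap⟩

/-- If `X` is a Polish (metric) space such that `X × ℕ^ℕ` embeds into `X`, then every
analytic family `F ⊆ K(X)` is equivalent to a Gδ family `G ⊆ K(X)`: every member of `F`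
is homeomorphic to a member of `G` and vice versa. -/
theorem analytic_family_equivalent_to_Gdelta
    {X : Type*} [MetricSpace X] [PolishSpace X]
    (e : X × (ℕ → ℕ) → X) (he : Topology.IsEmbedding e)
    (F : Set (NonemptyCompacts X)) (hF : MeasureTheory.AnalyticSet F) :
    ∃ G : Set (NonemptyCompacts X), IsGδ G ∧
      (∀ A ∈ F, ∃ B ∈ G, Nonempty (↥(A : Set X) ≃ₜ ↥(B : Set X))) ∧
      (∀ B ∈ G, ∃ A ∈ F, Nonempty (↥(A : Set X) ≃ₜ ↥(B : Set X))) := by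
  rw [MeasureTheory.AnalyticSet] at hF
  obtain rfl | ⟨f, hf, rfl⟩ := hF
  · exact ⟨∅, .empty, by simp, by simp⟩
  let φ : (ℕ → ℕ) → NonemptyCompacts (X × (ℕ → ℕ)) := fun a => f a ×ˢ {a}
  have hφ : Continuous φ :=
    NonemptyCompacts.continuous_prod.comp (hf.prodMk NonemptyCompacts.continuous_singleton)
  have hφe : Topology.IsEmbedding φ := by
    refine .of_comp hφ (continuous_snd.nonemptyCompacts_map) ?_
    convert NonemptyCompacts.isEmbedding_singleton (α := ℕ → ℕ) using 1
    ext1 a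
    exact NonemptyCompacts.ext (Set.snd_image_prod (f a).nonempty _)
  have homeo (a : ℕ → ℕ) :
      Nonempty (↥(f a : Set X) ≃ₜ ↥((φ a).map e he.continuous : Set X)) := by
    have hg : Topology.IsEmbedding fun x : X => e (x, a) :=
      he.comp (isEmbedding_prodMkLeft a)
    have hs : ((φ a).map e he.continuous : Set X) = (fun x => e (x, a)) '' (f a) := by
      simp [φ, Set.prod_singleton, Set.image_image]
    exact ⟨(hg.homeomorphImage _).trans (Homeomorph.setCongr hs.symm)⟩
  refine ⟨_, (he.nonemptyCompacts_map.comp hφe).isGδ_range, ?_, ?_⟩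
  · rintro _ ⟨a, rfl⟩
    exact ⟨_, ⟨a, rfl⟩, homeo a⟩
  · rintro _ ⟨a, rfl⟩
    exact ⟨_, ⟨a, rfl⟩, homeo a⟩
end

section
/- Let X be a metric space and K(X) the hyperspace of nonempty compact subsets of X with the Hausdorff metric. (1) For every A ∈ K(X), the family K(A) := {K ∈ K(X) : K ⊆ A} is a nonempty compact subset of K(X), and the map K(X) → K(K(X)) sending A to K(A) is continuous. (2) The projection (A, B) ↦ B from the relation R = {(A,B) ∈ K(X) × K(X) : A ⊆ B} onto K(X) is both a closed map and an open map. -/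
open TopologicalSpace

namespace TopologicalSpace.NonemptyCompacts

open Metric

theorem exists_subset_edist_le {X : Type*} [EMetricSpace X] {A B K : NonemptyCompacts X}
    (hK : (K : Set X) ⊆ A) :
    ∃ L : NonemptyCompacts X, (L : Set X) ⊆ B ∧ edist K L ≤ edist A B := by
  have near : ∀ x ∈ K, ∃ y ∈ B, edist x y ≤ edist A B := by
    intro x hx
    obtain ⟨y, hy, hxy⟩ := B.isCompact.exists_infEDist_eq_edist B.nonempty x
    exact ⟨y, hy, hxy ▸ infEDist_le_hausdorffEDist_of_mem (hK hx)⟩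
  let S : Set X := {y | infEDist y K ≤ edist A B}
  have mem_S : ∀ {x y}, x ∈ K → edist x y ≤ edist A B → y ∈ S := fun {x y} hx hxy =>
    (infEDist_le_edist_of_mem hx).trans (edist_comm y x ▸ hxy)
  have hS : IsClosed S := isClosed_le continuous_infEDist continuous_const
  refine ⟨⟨⟨B ∩ S, B.isCompact.inter_right hS⟩, ?_⟩, Set.inter_subset_left, ?_⟩
  · obtain ⟨x, hx⟩ := K.nonempty
    obtain ⟨y, hy, hxy⟩ := near x hx
    exact ⟨y, hy, mem_S hx hxy⟩
  · refine hausdorffEDist_le_of_mem_edist (fun x hx => ?_) (fun y hy => ?_)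
    · obtain ⟨y, hy, hxy⟩ := near x hx
      exact ⟨y, ⟨hy, mem_S hx hxy⟩, hxy⟩
    · obtain ⟨x, hx, hyx⟩ := K.isCompact.exists_infEDist_eq_edist K.nonempty y
      exact ⟨x, hx, hyx ▸ hy.2⟩

/-- The hyperspace of nonempty compact subsets of `A`, as a nonempty compact subset of the
hyperspace of the ambient space. -/
def subsets {X : Type*} [TopologicalSpace X] (A : NonemptyCompacts X) :
    NonemptyCompacts (NonemptyCompacts X) where
  carrier := {K | (K : Set X) ⊆ A}
  isCompact' := isCompact_subsets_of_isCompact A.isCompact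
  nonempty' := ⟨A, Set.Subset.rfl (s := (A : Set X))⟩

theorem coe_subsets {X : Type*} [TopologicalSpace X] (A : NonemptyCompacts X) :
    (subsets A : Set (NonemptyCompacts X)) = {K : NonemptyCompacts X | (K : Set X) ⊆ A} :=
  rfl

theorem mem_subsets {X : Type*} [TopologicalSpace X] {A K : NonemptyCompacts X} :
    K ∈ subsets A ↔ (K : Set X) ⊆ A :=
  Iff.rfl

theorem lipschitzWith_subsets {X : Type*} [EMetricSpace X] :
    LipschitzWith 1 (subsets (X := X)) := by
  intro A B
  rw [ENNReal.coe_one, one_mul]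
  refine hausdorffEDist_le_of_mem_edist
    (fun K hK => exists_subset_edist_le (mem_subsets.mp hK)) (fun K hK => ?_)
  rw [edist_comm A B]
  exact exists_subset_edist_le (mem_subsets.mp hK)

theorem isClosedMap_snd_of_subset {X : Type*} [EMetricSpace X] :
    IsClosedMap (fun p : {p : NonemptyCompacts X × NonemptyCompacts X //
      (p.1 : Set X) ⊆ (p.2 : Set X)} => p.1.2) := by
  intro Z hZ
  obtain ⟨W, hW, rfl⟩ := isClosed_induced_iff.mp hZ
  rw [← isOpen_compl_iff, isOpen_iff_mem_nhds]
  intro B hB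
  obtain ⟨U, V, hU, hV, hBU, hBV, hUV⟩ := generalized_tube_lemma
    (subsets B).isCompact (isCompact_singleton (x := B)) hW.isOpen_compl
    (by
      rintro ⟨K, B'⟩ ⟨hK, rfl : B' = B⟩
      exact fun h => hB ⟨⟨(K, B'), hK⟩, h, rfl⟩)
  filter_upwards [hV.mem_nhds (hBV rfl),
    ((isOpen_subsets_of_isOpen hU).preimage lipschitzWith_subsets.continuous).mem_nhds hBU]
  rintro _ hB'V hB'U ⟨⟨⟨K, B'⟩, hK⟩, hKW, rfl⟩
  exact hUV ⟨hB'U (mem_subsets.mpr hK), hB'V⟩ hKW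

theorem isOpenMap_snd_of_subset {X : Type*} [EMetricSpace X] :
    IsOpenMap (fun p : {p : NonemptyCompacts X × NonemptyCompacts X //
      (p.1 : Set X) ⊆ (p.2 : Set X)} => p.1.2) := by
  rintro _ ⟨W, hW, rfl⟩
  rw [EMetric.isOpen_iff] at hW ⊢
  rintro _ ⟨⟨⟨A, B⟩, hAB⟩, hp, rfl⟩
  obtain ⟨ε, hε, hball⟩ := hW _ hp
  refine ⟨ε, hε, fun B' hB' => ?_⟩
  obtain ⟨A', hA', hdist⟩ := exists_subset_edist_le (B := B') hAB
  refine ⟨⟨(A', B'), hA'⟩, hball ?_, rfl⟩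
  rw [mem_eball, edist_comm] at hB' ⊢
  exact max_lt (hdist.trans_lt hB') hB'

end TopologicalSpace.NonemptyCompacts

/-- (1) For every nonempty compact `A ⊆ X`, the family `K(A) = {K ∈ K(X) : K ⊆ A}` is a
nonempty compact subset of the hyperspace `K(X)`, and the map `A ↦ K(A)`, viewed as a map
`K(X) → K(K(X))`, is continuous.
(2) The projection `(A, B) ↦ B` from the inclusion relation `{(A,B) : A ⊆ B} ⊆ K(X) × K(X)`
onto `K(X)` is both closed and open. -/
theorem hyperspace_map_continuous_and_projection_closed_open
    (X : Type*) [MetricSpace X] :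
    ((∀ A : NonemptyCompacts X,
        ({K : NonemptyCompacts X | (K : Set X) ⊆ (A : Set X)}).Nonempty ∧
        IsCompact {K : NonemptyCompacts X | (K : Set X) ⊆ (A : Set X)}) ∧
      ∃ φ : NonemptyCompacts X → NonemptyCompacts (NonemptyCompacts X),
        Continuous φ ∧
        ∀ A : NonemptyCompacts X,
          (φ A : Set (NonemptyCompacts X)) = {K : NonemptyCompacts X | (K : Set X) ⊆ (A : Set X)}) ∧
    (IsClosedMap
        (fun p : {p : NonemptyCompacts X × NonemptyCompacts X // (p.1 : Set X) ⊆ (p.2 : Set X)} =>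
          p.1.2) ∧
      IsOpenMap
        (fun p : {p : NonemptyCompacts X × NonemptyCompacts X // (p.1 : Set X) ⊆ (p.2 : Set X)} =>
          p.1.2)) := by
  open NonemptyCompacts in
  exact ⟨⟨fun A => ⟨coe_subsets A ▸ (subsets A).nonempty, coe_subsets A ▸ (subsets A).isCompact⟩,
    subsets, lipschitzWith_subsets.continuous, coe_subsets⟩,
    isClosedMap_snd_of_subset, isOpenMap_snd_of_subset⟩
end

section
/- Let A and B be Polish spaces and let q : A → B be a continuous closed map all of whose fibers q⁻¹(b) are compact (i.e. q is perfect). Then the family of nonempty fibers of q, namely {K ∈ K(A) : ∃ b ∈ B, K = q⁻¹(b)}, is a Gδ subset of the hyperspace K(A) of nonempty compact subsets of A with the Hausdorff metric. -/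
open TopologicalSpace

/-- The compact sets on which a continuous map to a Hausdorff space is constant form a
closed set. -/
lemma isClosed_nonemptyCompacts_image_subsingleton {A B : Type*} [TopologicalSpace A]
    [TopologicalSpace B] [T2Space B] {q : A → B} (hq : Continuous q) :
    IsClosed {K : NonemptyCompacts A | (q '' (K : Set A)).Subsingleton} := by
  have h := (NonemptyCompacts.isClosedEmbedding_singleton (α := B)).isClosed_range.preimage
    hq.nonemptyCompacts_map
  convert h using 1
  ext K
  simp only [Set.mem_ofPred_eq, Set.mem_preimage, Set.mem_range]
  constructor
  · intro hK
    obtain ⟨x, hx⟩ := K.nonempty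
    refine ⟨q x, SetLike.coe_injective ?_⟩
    simpa using (hK.eq_singleton_of_mem (Set.mem_image_of_mem q hx)).symm
  · rintro ⟨b, hb⟩
    have := congrArg SetLike.coe hb
    simp only [NonemptyCompacts.coe_singleton, NonemptyCompacts.coe_map] at this
    rw [← this]
    exact Set.subsingleton_singleton

/-- A nonempty compact set is a fiber iff the map is constant on it and every member of a basis
whose closure misses the set also has closure missing its saturation. -/
lemma exists_eq_preimage_singleton_iff {A B : Type*} [TopologicalSpace A] [T3Space A]
    {q : A → B} {𝓑 : Set (Set A)} (h𝓑 : IsTopologicalBasis 𝓑) (K : NonemptyCompacts A) :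
    (∃ b : B, (K : Set A) = q ⁻¹' {b}) ↔
      (q '' (K : Set A)).Subsingleton ∧ ∀ U ∈ 𝓑,
        ((K : Set A) ∩ closure U).Nonempty ∨ (K : Set A) ⊆ (q ⁻¹' (q '' closure U))ᶜ := by
  constructor
  · rintro ⟨b, hb⟩
    rw [hb]
    refine ⟨Set.subsingleton_singleton.anti (Set.image_preimage_subset q {b}), fun U _ ↦ ?_⟩
    refine or_iff_not_imp_right.2 fun h ↦ ?_
    obtain ⟨x, hx, hxU⟩ := Set.not_subset.1 h
    obtain ⟨y, hyU, hyx⟩ := not_not.1 hxU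
    exact ⟨y, hyx.trans hx, hyU⟩
  · rintro ⟨hK, hU⟩
    obtain ⟨x, hx⟩ := K.nonempty
    refine ⟨q x, Set.Subset.antisymm
      (fun y hy ↦ hK (Set.mem_image_of_mem q hy) (Set.mem_image_of_mem q hx)) fun y hy ↦ ?_⟩
    by_contra hyK
    obtain ⟨U, hU𝓑, hyU, hUK⟩ := h𝓑.exists_closure_subset
      (K.isCompact.isClosed.isOpen_compl.mem_nhds hyK)
    rcases hU U hU𝓑 with ⟨z, hzK, hzU⟩ | h
    · exact hUK hzU hzK
    · exact h hx ⟨y, subset_closure hyU, hy⟩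

/-- If `q : A → B` is a continuous closed map between Polish spaces with compact fibers
(i.e. `q` is perfect), then the family of nonempty fibers of `q` is a Gδ subset of the
hyperspace `K(A)` of nonempty compact subsets of `A`. -/
theorem fibers_of_perfect_map_Gdelta
    {A B : Type*} [MetricSpace A] [PolishSpace A] [MetricSpace B] [PolishSpace B]
    (q : A → B) (hq : Continuous q) (hclosed : IsClosedMap q)
    (hfib : ∀ b : B, IsCompact (q ⁻¹' {b})) :
    IsGδ {K : NonemptyCompacts A | ∃ b : B, (K : Set A) = q ⁻¹' {b}} := by
  simp only [exists_eq_preimage_singleton_iff (isBasis_countableBasis A), Set.ofPred_and,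
    Set.ofPred_forall, Set.ofPred_or]
  refine (isClosed_nonemptyCompacts_image_subsingleton hq).isGδ.inter <|
    .biInter (countable_countableBasis A) fun U _ ↦ .union ?_ ?_
  · exact (NonemptyCompacts.isClosed_inter_nonempty_of_isClosed isClosed_closure).isGδ
  · exact (NonemptyCompacts.isOpen_subsets_of_isOpen
      ((hclosed _ isClosed_closure).preimage hq).isOpen_compl).isGδ
end

section
/- Let X and Y be metric spaces and let K(X × Y) be the hyperspace of nonempty compact subsets of X × Y with the Hausdorff metric. Then: (1) the set {G ∈ K(X × Y) : the first-coordinate projection is injective on G} is a Gδ subset of K(X × Y); and (2) the set {G ∈ K(X × Y) : both coordinate projections are injective on G} is a Gδ subset of K(X × Y). -/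
open TopologicalSpace

/-- The compact sets on which a continuous map is injective form a Gδ set in the hyperspace. -/
theorem isGδ_setOf_injOn_nonemptyCompacts {Z W : Type*} [MetricSpace Z] [TopologicalSpace W]
    [T2Space W] {f : Z → W} (hf : Continuous f) :
    IsGδ {G : NonemptyCompacts Z | Set.InjOn f (G : Set Z)} := by
  let U : ℕ → Set (Z × Z) := fun n => {p | f p.1 ≠ f p.2 ∨ dist p.1 p.2 < 1 / ((n : ℝ) + 1)}
  have hU (n : ℕ) : IsOpen (U n) :=
    (isOpen_ne_fun (hf.comp continuous_fst) (hf.comp continuous_snd)).union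
      (isOpen_lt continuous_dist continuous_const)
  have hsquare : Continuous fun G : NonemptyCompacts Z => G ×ˢ G :=
    (NonemptyCompacts.lipschitz_prod (α := Z) (β := Z)).continuous.comp
      (continuous_id.prodMk continuous_id)
  have heq : {G : NonemptyCompacts Z | Set.InjOn f (G : Set Z)} =
      ⋂ n, (fun G : NonemptyCompacts Z => G ×ˢ G) ⁻¹'
        {K : NonemptyCompacts (Z × Z) | (K : Set (Z × Z)) ⊆ U n} := by
    ext G
    simp only [Set.mem_iInter, Set.mem_preimage, Set.mem_ofPred_eq, NonemptyCompacts.coe_prod]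
    constructor
    · rintro hG n ⟨p, q⟩ ⟨hp, hq⟩
      by_cases h : f p = f q
      · right
        obtain rfl : p = q := hG hp hq h
        simpa using Nat.cast_add_one_pos n
      · exact Or.inl h
    · intro hG p hp q hq h
      by_contra hpq
      obtain ⟨n, hn⟩ := exists_nat_one_div_lt (dist_pos.2 hpq)
      rcases hG n (Set.mk_mem_prod hp hq) with h' | h'
      · exact h' h
      · exact lt_asymm hn h'
  rw [heq]
  exact IsGδ.iInter_of_isOpen fun n =>
    (NonemptyCompacts.isOpen_subsets_of_isOpen (hU n)).preimage hsquare

/-- In the hyperspace `K(X × Y)` of nonempty compact subsets of `X × Y`: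
(1) the set of compact sets on which the first-coordinate projection is injective
(the graphs of partial continuous surjections) is Gδ, and
(2) the set of compact sets on which both coordinate projections are injective
(the graphs of partial homeomorphisms) is Gδ. -/
theorem partial_graphs_Gdelta
    (X Y : Type*) [MetricSpace X] [MetricSpace Y] :
    IsGδ {G : NonemptyCompacts (X × Y) |
      Set.InjOn Prod.fst (G : Set (X × Y))} ∧
    IsGδ {G : NonemptyCompacts (X × Y) |
      Set.InjOn Prod.fst (G : Set (X × Y)) ∧ Set.InjOn Prod.snd (G : Set (X × Y))} := by
  have hfst := isGδ_setOf_injOn_nonemptyCompacts (Z := X × Y) continuous_fst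
  exact ⟨hfst, hfst.inter (isGδ_setOf_injOn_nonemptyCompacts continuous_snd)⟩
end

section
/- Let X be a Polish space and let F be an analytic subset of the hyperspace K(Q) of nonempty compact subsets of the Hilbert cube Q = [0,1]^ℕ. Then the set {K ∈ K(X) : K is homeomorphic to some member of F} is an analytic subset of K(X). -/
open TopologicalSpace

/-- A metric on the Hilbert cube `[0,1]^ℕ` inducing the product topology. -/
noncomputable instance : MetricSpace (ℕ → unitInterval) := PiCountable.metricSpace

open MeasureTheory

theorem MeasureTheory.AnalyticSet.inter {α : Type*} [TopologicalSpace α] [T2Space α]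
    {s t : Set α} (hs : AnalyticSet s) (ht : AnalyticSet t) : AnalyticSet (s ∩ t) := by
  rw [Set.inter_eq_iInter]
  exact .iInter (Bool.forall_bool.2 ⟨ht, hs⟩)

theorem IsGδ.analyticSet {α : Type*} [TopologicalSpace α] [PolishSpace α] {s : Set α}
    (hs : IsGδ s) : AnalyticSet s := by
  borelize α
  exact hs.measurableSet.analyticSet

namespace TopologicalSpace.NonemptyCompacts

instance polishSpace {α : Type*} [TopologicalSpace α] [PolishSpace α] :
    PolishSpace (NonemptyCompacts α) := by
  let := upgradeIsCompletelyMetrizable α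
  infer_instance

/-- The compact sets on which a continuous map is injective form a `Gδ` set. -/
theorem isGδ_setOf_injOn {α β : Type*} [TopologicalSpace α] [MetrizableSpace α]
    [TopologicalSpace β] [T2Space β] {f : α → β} (hf : Continuous f) :
    IsGδ {K : NonemptyCompacts α | Set.InjOn f K} := by
  let := metrizableSpaceMetric (α × α)
  obtain ⟨U, hU, hdiag⟩ := (isClosed_diagonal (X := α)).isGδ.eq_iInter_nat
  have key : {K : NonemptyCompacts α | Set.InjOn f K} =
      ⋂ n, {K : NonemptyCompacts α |
        ((K ×ˢ K : NonemptyCompacts (α × α)) : Set (α × α)) ⊆ {p | f p.1 ≠ f p.2} ∪ U n} := by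
    ext K
    simp only [Set.mem_iInter, Set.mem_ofPred_eq]
    constructor
    · rintro hK n ⟨x, y⟩ ⟨hx, hy⟩
      by_cases hxy : f x = f y
      · have : (x, y) ∈ Set.diagonal α := hK hx hy hxy
        rw [hdiag] at this
        exact .inr (Set.mem_iInter.1 this n)
      · exact .inl hxy
    · intro hK x hx y hy hxy
      have : (x, y) ∈ Set.diagonal α := by
        rw [hdiag]
        exact Set.mem_iInter.2 fun n =>
          (hK n (Set.mk_mem_prod hx hy)).resolve_left fun h => h hxy
      exact this
  rw [key]
  refine .iInter_of_isOpen fun n => (isOpen_subsets_of_isOpen ?_).preimage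
    (continuous_prod.comp (continuous_id.prodMk continuous_id))
  exact (isOpen_ne_fun (hf.comp continuous_fst) (hf.comp continuous_snd)).union (hU n)

/-- A continuous map that is injective on a compact set restricts to a homeomorphism onto the
image. -/
theorem nonempty_homeomorph_map {α β : Type*} [TopologicalSpace α] [TopologicalSpace β]
    [T2Space β] {f : α → β} (hf : Continuous f) {K : NonemptyCompacts α} (hK : Set.InjOn f K) :
    Nonempty (↥(K : Set α) ≃ₜ ↥(K.map f hf : Set β)) :=
  have : CompactSpace (K : Set α) := isCompact_iff_compactSpace.1 K.isCompact
  ⟨Continuous.homeoOfEquivCompactToT2 (f := Equiv.Set.imageOfInjOn f K hK)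
    ((hf.comp continuous_subtype_val).subtype_mk _)⟩

/-- Two nonempty compact sets are homeomorphic if and only if they are the projections of a compact
subset of the product on which both projections are injective. -/
theorem nonempty_homeomorph_iff {α β : Type*} [TopologicalSpace α] [T2Space α]
    [TopologicalSpace β] [T2Space β] {K : NonemptyCompacts α} {C : NonemptyCompacts β} :
    Nonempty (↥(K : Set α) ≃ₜ ↥(C : Set β)) ↔
      ∃ L : NonemptyCompacts (α × β), Set.InjOn Prod.fst (L : Set (α × β)) ∧
        Set.InjOn Prod.snd (L : Set (α × β)) ∧
        L.map Prod.fst continuous_fst = K ∧ L.map Prod.snd continuous_snd = C := by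
  constructor
  · rintro ⟨e⟩
    have : CompactSpace (K : Set α) := isCompact_iff_compactSpace.1 K.isCompact
    have : Nonempty (K : Set α) := K.nonempty.to_subtype
    have hg : Continuous fun x : (K : Set α) => ((x : α), (e x : β)) := by fun_prop
    refine ⟨⟨⟨Set.range fun x : (K : Set α) => ((x : α), (e x : β)), isCompact_range hg⟩,
      Set.range_nonempty _⟩, ?_, ?_, ?_, ?_⟩
    · rintro _ ⟨x, rfl⟩ _ ⟨y, rfl⟩ hxy
      rw [Subtype.ext hxy]
    · rintro _ ⟨x, rfl⟩ _ ⟨y, rfl⟩ hxy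
      rw [e.injective (Subtype.ext hxy)]
    · ext a
      simp [← Set.range_comp, Function.comp_def]
    · ext b
      change b ∈ Prod.snd '' Set.range _ ↔ _
      rw [← Set.range_comp]
      change b ∈ Set.range (Subtype.val ∘ e) ↔ _
      rw [e.surjective.range_comp, Subtype.range_coe]
  · rintro ⟨L, h₁, h₂, rfl, rfl⟩
    obtain ⟨e₁⟩ := nonempty_homeomorph_map continuous_fst h₁
    obtain ⟨e₂⟩ := nonempty_homeomorph_map continuous_snd h₂
    exact ⟨e₁.symm.trans e₂⟩

/-- The compact subsets of a Polish space homeomorphic to a member of an analytic family of compact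
subsets of another Polish space form an analytic set. -/
theorem analyticSet_setOf_homeomorph {α β : Type*} [TopologicalSpace α] [PolishSpace α]
    [TopologicalSpace β] [PolishSpace β] {F : Set (NonemptyCompacts β)} (hF : AnalyticSet F) :
    AnalyticSet {K : NonemptyCompacts α |
      ∃ C ∈ F, Nonempty (↥(K : Set α) ≃ₜ ↥(C : Set β))} := by
  have key : {K : NonemptyCompacts α | ∃ C ∈ F, Nonempty (↥(K : Set α) ≃ₜ ↥(C : Set β))} =
      NonemptyCompacts.map Prod.fst continuous_fst ''
        (({L : NonemptyCompacts (α × β) | Set.InjOn Prod.fst (L : Set (α × β))} ∩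
          {L : NonemptyCompacts (α × β) | Set.InjOn Prod.snd (L : Set (α × β))}) ∩
          NonemptyCompacts.map Prod.snd continuous_snd ⁻¹' F) := by
    ext K
    simp only [nonempty_homeomorph_iff]
    constructor
    · rintro ⟨_, hC, L, h₁, h₂, rfl, rfl⟩
      exact ⟨L, ⟨⟨h₁, h₂⟩, hC⟩, rfl⟩
    · rintro ⟨L, ⟨⟨h₁, h₂⟩, hC⟩, rfl⟩
      exact ⟨_, hC, L, h₁, h₂, rfl, rfl⟩
  rw [key]
  exact (((isGδ_setOf_injOn continuous_fst).inter
    (isGδ_setOf_injOn continuous_snd)).analyticSet.inter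
      (hF.preimage continuous_snd.nonemptyCompacts_map)).image_of_continuous
        continuous_fst.nonemptyCompacts_map

end TopologicalSpace.NonemptyCompacts

/-- If `F` is an analytic family in the hyperspace `K(Q)` of nonempty compact subsets of
the Hilbert cube `Q = [0,1]^ℕ`, and `X` is a Polish space, then the family of all
nonempty compact subsets of `X` homeomorphic to some member of `F` is analytic in `K(X)`. -/
theorem homeomorphism_saturation_analytic
    {X : Type*} [MetricSpace X] [PolishSpace X]
    (F : Set (NonemptyCompacts (ℕ → unitInterval)))
    (hF : MeasureTheory.AnalyticSet F) :
    MeasureTheory.AnalyticSet {K : NonemptyCompacts X |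
      ∃ C ∈ F, Nonempty (↥(K : Set X) ≃ₜ ↥(C : Set (ℕ → unitInterval)))} :=
  NonemptyCompacts.analyticSet_setOf_homeomorph hF
end

section
/- There exists a closed set F ⊆ Q × 2^ℕ, where Q = [0,1]^ℕ is the Hilbert cube and 2^ℕ is the Cantor space, such that every section F^b (b ∈ 2^ℕ) is a Peano continuum, i.e. a nonempty compact set that is a continuous image of the unit interval [0,1], and every Peano continuum contained in Q is homeomorphic to some section F^b. In other words, the class of all Peano continua is compactifiable. -/
/-- A subset of the Hilbert cube is a Peano continuum iff it is a continuous image of the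
unit interval (such a set is automatically nonempty and compact). -/
def IsPeano (S : Set (ℕ → unitInterval)) : Prop :=
  ∃ f : unitInterval → (ℕ → unitInterval), Continuous f ∧ Set.range f = S

open Set Filter Topology unitInterval

namespace PeanoTube

/-- A sequence of maps `I → I`, regarded as a path in the Hilbert cube. -/
abbrev Path : Type := ℕ → C(I, I)

/-- Coordinatewise closeness of paths: the `n`-th coordinates differ by at most `2 ^ n * r`. -/
def IsNear (φ ψ : Path) (r : ℝ) : Prop :=
  ∀ n t, |(φ n t : ℝ) - ψ n t| ≤ 2 ^ n * r

/-- The closed tube of radius `r` around the image of `φ` in the Hilbert cube. -/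
def tube (φ : Path) (r : ℝ) : Set (ℕ → I) :=
  {x | ∃ t, ∀ n, |(x n : ℝ) - φ n t| ≤ 2 ^ n * r}

lemma abs_sub_le_one (x y : I) : |(x : ℝ) - y| ≤ 1 := by
  rw [abs_le]
  constructor <;> linarith [x.2.1, x.2.2, y.2.1, y.2.2]

lemma IsNear.trans {φ ψ χ : Path} {r s : ℝ} (h₁ : IsNear φ ψ r) (h₂ : IsNear ψ χ s) :
    IsNear φ χ (r + s) := fun n t => by
  have := abs_sub_le (φ n t : ℝ) (ψ n t) (χ n t)
  linarith [h₁ n t, h₂ n t, mul_add ((2 : ℝ) ^ n) r s]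

lemma IsNear.symm {φ ψ : Path} {r : ℝ} (h : IsNear φ ψ r) : IsNear ψ φ r := fun n t => by
  rw [abs_sub_comm]
  exact h n t

lemma IsNear.mono {φ ψ : Path} {r s : ℝ} (h : IsNear φ ψ r) (hrs : r ≤ s) : IsNear φ ψ s :=
  fun n t => (h n t).trans (mul_le_mul_of_nonneg_left hrs (by positivity))

lemma isNear_of_one_le (φ ψ : Path) {r : ℝ} (hr : 1 ≤ r) : IsNear φ ψ r := fun _ _ =>
  (abs_sub_le_one _ _).trans (one_le_mul_of_one_le_of_one_le (one_le_pow₀ one_le_two) hr)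

lemma tube_subset_tube {φ ψ : Path} {r s : ℝ} (h : IsNear φ ψ (r - s)) :
    tube ψ s ⊆ tube φ r := by
  rintro x ⟨t, ht⟩
  refine ⟨t, fun n => ?_⟩
  have := abs_sub_le (x n : ℝ) (ψ n t) (φ n t)
  linarith [ht n, h.symm n t, mul_sub ((2 : ℝ) ^ n) r s]

/-- The paths near a given one form a neighbourhood. -/
lemma setOf_isNear_mem_nhds (φ : Path) {r : ℝ} (hr : 0 < r) : {ψ | IsNear ψ φ r} ∈ 𝓝 φ := by
  obtain ⟨N, hN⟩ := pow_unbounded_of_one_lt r⁻¹ (one_lt_two (α := ℝ))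
  have hmem : (Set.pi (Finset.range N : Set ℕ) fun n => Metric.ball (φ n) r) ∈ 𝓝 φ :=
    set_pi_mem_nhds (Finset.finite_toSet _) fun n _ => Metric.ball_mem_nhds _ hr
  filter_upwards [hmem] with ψ hψ n t
  have h1 : (1 : ℝ) ≤ 2 ^ n := one_le_pow₀ one_le_two
  rcases lt_or_ge n N with hn | hn
  · have hd : dist (ψ n) (φ n) < r := hψ n (by simpa using hn)
    have ht : |(ψ n t : ℝ) - φ n t| ≤ dist (ψ n) (φ n) :=
      ContinuousMap.dist_apply_le_dist (f := ψ n) (g := φ n) t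
    nlinarith
  · have h2 : (2 : ℝ) ^ N ≤ 2 ^ n := pow_le_pow_right₀ one_le_two hn
    have h3 : 1 ≤ (2 : ℝ) ^ N * r := by
      rw [inv_lt_iff_one_lt_mul₀ hr] at hN
      linarith
    refine (abs_sub_le_one _ _).trans (h3.trans ?_)
    gcongr

/-- The product of the interval with the Hilbert cube is a continuous image of the interval. -/
lemma exists_continuous_surjective_prod :
    ∃ f : I → I × (ℕ → I), Continuous f ∧ Function.Surjective f := by
  let _ : MetricSpace (I × (ℕ → I)) := TopologicalSpace.metrizableSpaceMetric _
  obtain ⟨h, hc, hs⟩ := exists_nat_bool_continuous_surjective_of_compact (I × (ℕ → I))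
  have : CompactSpace cantorSet := isCompact_iff_compactSpace.1 isCompact_cantorSet
  let e : cantorSet → I := Set.inclusion cantorSet_subset_unitInterval
  have hec : IsClosedEmbedding e :=
    (continuous_inclusion cantorSet_subset_unitInterval).isClosedEmbedding
      (Set.inclusion_injective cantorSet_subset_unitInterval)
  let h' : C(cantorSet, I × (ℕ → I)) :=
    ⟨h ∘ cantorSetHomeomorphNatToBool, hc.comp cantorSetHomeomorphNatToBool.continuous⟩
  obtain ⟨g, hg⟩ := ContinuousMap.exists_extension' hec h'
  refine ⟨g, g.continuous, Function.Surjective.of_comp (g := e) ?_⟩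
  rw [hg]
  exact hs.comp cantorSetHomeomorphNatToBool.surjective

lemma isPeano_tube (φ : Path) {r : ℝ} (hr : 0 < r) : IsPeano (tube φ r) := by
  let c : I × (ℕ → I) → (ℕ → I) := fun p n =>
    Set.projIcc (0 : ℝ) 1 zero_le_one ((φ n p.1 : ℝ) + 2 ^ n * r * (2 * p.2 n - 1))
  have hc : Continuous c := by
    refine continuous_pi fun n => continuous_projIcc.comp ?_
    fun_prop
  have hrange : Set.range c = tube φ r := by
    ext x
    constructor
    · rintro ⟨⟨t, q⟩, rfl⟩
      refine ⟨t, fun n => ?_⟩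
      have hd : 0 < 2 ^ n * r := by positivity
      have hq := (q n).2
      have ht := (φ n t).2
      simp only [c, Set.coe_projIcc]
      have h1 : 2 ^ n * r * (2 * (q n : ℝ) - 1) ≤ 2 ^ n * r := by nlinarith [hq.1, hq.2]
      have h2 : -(2 ^ n * r) ≤ 2 ^ n * r * (2 * (q n : ℝ) - 1) := by nlinarith [hq.1, hq.2]
      rw [abs_le]
      constructor
      · have := le_max_right (0 : ℝ)
          (min 1 ((φ n t : ℝ) + 2 ^ n * r * (2 * (q n : ℝ) - 1)))
        have h3 : (φ n t : ℝ) - 2 ^ n * r ≤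
            min 1 ((φ n t : ℝ) + 2 ^ n * r * (2 * (q n : ℝ) - 1)) :=
          le_min (by linarith [ht.2]) (by linarith)
        linarith
      · have h3 : max 0 (min 1 ((φ n t : ℝ) + 2 ^ n * r * (2 * (q n : ℝ) - 1))) ≤
            (φ n t : ℝ) + 2 ^ n * r :=
          max_le (by linarith [ht.1]) ((min_le_right _ _).trans (by linarith))
        linarith
    · rintro ⟨t, ht⟩
      have hd : ∀ n, 0 < 2 ^ n * r := fun n => by positivity
      refine ⟨(t, fun n => ⟨(((x n : ℝ) - φ n t) / (2 ^ n * r) + 1) / 2, ?_, ?_⟩), ?_⟩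
      · have := (le_div_iff₀ (hd n)).2 (by linarith [(abs_le.1 (ht n)).1] :
          -1 * (2 ^ n * r) ≤ (x n : ℝ) - φ n t)
        linarith
      · have := (div_le_iff₀ (hd n)).2 (by linarith [(abs_le.1 (ht n)).2] :
          (x n : ℝ) - φ n t ≤ 1 * (2 ^ n * r))
        linarith
      · funext n
        have hx : (φ n t : ℝ) + 2 ^ n * r *
            (2 * ((((x n : ℝ) - φ n t) / (2 ^ n * r) + 1) / 2) - 1) = x n := by
          have := (hd n).ne'
          field_simp
          ring
        simp only [c]
        rw [hx]
        exact Set.projIcc_val _ _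
  obtain ⟨f, hf, hs⟩ := exists_continuous_surjective_prod
  exact ⟨c ∘ f, hc.comp hf, by rw [hs.range_comp, hrange]⟩

lemma isClosed_of_isPeano {S : Set (ℕ → I)} (hS : IsPeano S) : IsClosed S := by
  obtain ⟨f, hf, rfl⟩ := hS
  exact (isCompact_range hf).isClosed

/-- If paths converge to `f` at rate `r`, then the tubes around them intersect in the image
of `f`. -/
lemma iInter_tube_eq_range {φ : ℕ → Path} {r : ℕ → ℝ} {f : Path}
    (hφ : ∀ k, IsNear (φ k) f (r k)) (hr : Tendsto r atTop (𝓝 0)) :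
    ⋂ k, tube (φ k) (r k) = Set.range fun t n => f n t := by
  apply Set.Subset.antisymm
  · intro x hx
    rw [Set.mem_iInter] at hx
    choose t ht using hx
    obtain ⟨a, -, u, hu, ha⟩ := isCompact_univ.tendsto_subseq fun k => Set.mem_univ (t k)
    refine ⟨a, funext fun n => ?_⟩
    have h1 : Tendsto (fun k => |(x n : ℝ) - f n (t (u k))|) atTop (𝓝 |(x n : ℝ) - f n a|) := by
      have hc : Continuous fun s : I => |(x n : ℝ) - f n s| := by fun_prop
      exact (hc.tendsto a).comp ha
    have h2 : Tendsto (fun k => 2 ^ n * (r (u k) + r (u k))) atTop (𝓝 0) := by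
      have h := hr.comp hu.tendsto_atTop
      simpa using (h.add h).const_mul ((2 : ℝ) ^ n)
    have h3 : |(x n : ℝ) - f n a| ≤ 0 := le_of_tendsto_of_tendsto' h1 h2 fun k => by
      have := abs_sub_le (x n : ℝ) (φ (u k) n (t (u k))) (f n (t (u k)))
      linarith [ht (u k) n, hφ (u k) n (t (u k)), mul_add ((2 : ℝ) ^ n) (r (u k)) (r (u k))]
    exact Subtype.ext (sub_eq_zero.1 (abs_nonpos_iff.1 h3)).symm
  · rintro _ ⟨t, rfl⟩
    exact Set.mem_iInter.2 fun k => ⟨t, fun n => (hφ k).symm n t⟩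

lemma isNear_of_le {φ : ℕ → Path} {r : ℕ → ℝ}
    (h : ∀ k, IsNear (φ k) (φ (k + 1)) (r k - r (k + 1))) {k l : ℕ} (hkl : k ≤ l) :
    IsNear (φ k) (φ l) (r k - r l) := by
  induction l, hkl using Nat.le_induction with
  | base => intro n t; simp
  | succ l _ ih => exact (ih.trans (h l)).mono (by linarith)

/-- Paths whose successive distances telescope to a null sequence converge. -/
lemma exists_isNear_limit {φ : ℕ → Path} {r : ℕ → ℝ} (hr0 : ∀ k, 0 ≤ r k)
    (h : ∀ k, IsNear (φ k) (φ (k + 1)) (r k - r (k + 1))) (hr : Tendsto r atTop (𝓝 0)) :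
    ∃ f : Path, ∀ k, IsNear (φ k) f (r k) := by
  have hle : ∀ {k l : ℕ}, k ≤ l → IsNear (φ k) (φ l) (r k) := fun {_ l} hkl =>
    (isNear_of_le h hkl).mono (by linarith [hr0 l])
  have hlim : ∀ n, ∃ f : C(I, I), Tendsto (fun k => φ k n) atTop (𝓝 f) := by
    intro n
    refine cauchySeq_tendsto_of_complete (cauchySeq_of_le_tendsto_0' (fun k => 2 ^ n * r k) ?_ ?_)
    · intro k l hkl
      exact (ContinuousMap.dist_le (mul_nonneg (by positivity) (hr0 k))).2 fun t => hle hkl n t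
    · simpa using hr.const_mul ((2 : ℝ) ^ n)
  choose f hf using hlim
  refine ⟨f, fun k n t => ?_⟩
  have h1 : Tendsto (fun l => |(φ k n t : ℝ) - φ l n t|) atTop (𝓝 |(φ k n t : ℝ) - f n t|) := by
    have hc : Continuous fun g : C(I, I) => |(φ k n t : ℝ) - g t| := by fun_prop
    exact (hc.tendsto (f n)).comp (hf n)
  exact le_of_tendsto h1 ((eventually_ge_atTop k).mono fun l hl => hle hl n t)

open Classical in
/-- Replace the tube around `s.1` of radius `s.2` by the half as wide tube around `g` if the bit
is set and `g` is close enough for the tubes to be nested. -/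
noncomputable def step (g : Path) (s : Path × ℝ) (bit : Bool) : Path × ℝ :=
  if bit = true ∧ IsNear s.1 g (s.2 / 2) then (g, s.2 / 2) else s

/-- The path offered at time `k`: every member of a countable dense set is offered infinitely
often. -/
noncomputable def candidate (k : ℕ) : Path :=
  TopologicalSpace.denseSeq Path k.unpair.1

/-- The path and radius reached at time `k` when the bits of `b` tell which candidates to
accept. -/
noncomputable def state (b : ℕ → Bool) : ℕ → Path × ℝ
  | 0 => (candidate 0, 4)
  | k + 1 => step (candidate k) (state b k) (b k)

lemma step_eq_or (g : Path) (s : Path × ℝ) (bit : Bool) :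
    step g s bit = s ∨ IsNear s.1 g (s.2 / 2) ∧ step g s bit = (g, s.2 / 2) := by
  unfold step
  split_ifs with h
  · exact Or.inr ⟨h.2, rfl⟩
  · exact Or.inl rfl

lemma state_succ_eq_or (b : ℕ → Bool) (k : ℕ) :
    state b (k + 1) = state b k ∨ IsNear (state b k).1 (candidate k) ((state b k).2 / 2) ∧
      state b (k + 1) = (candidate k, (state b k).2 / 2) :=
  step_eq_or _ _ _

lemma radius_pos (b : ℕ → Bool) (k : ℕ) : 0 < (state b k).2 := by
  induction k with
  | zero => simp [state]
  | succ k ih =>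
    rcases state_succ_eq_or b k with h | ⟨-, h⟩ <;> rw [h]
    · exact ih
    · exact half_pos ih

lemma isNear_state_succ (b : ℕ → Bool) (k : ℕ) :
    IsNear (state b k).1 (state b (k + 1)).1 ((state b k).2 - (state b (k + 1)).2) := by
  rcases state_succ_eq_or b k with h | ⟨hn, h⟩ <;> rw [h]
  · intro n t
    simp
  · exact hn.mono (by linarith)

lemma radius_antitone (b : ℕ → Bool) : Antitone fun k => (state b k).2 :=
  antitone_nat_of_succ_le fun k => by
    rcases state_succ_eq_or b k with h | ⟨-, h⟩ <;> rw [h]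
    linarith [radius_pos b k]

/-- If the state changes infinitely often, the radii tend to zero. -/
lemma tendsto_radius {b : ℕ → Bool} (hb : ∀ K, ∃ k ≥ K, state b (k + 1) ≠ state b k) :
    Tendsto (fun k => (state b k).2) atTop (𝓝 0) := by
  have hex : ∀ m : ℕ, ∃ k, (state b k).2 ≤ 4 * (1 / 2) ^ m := by
    intro m
    induction m with
    | zero => exact ⟨0, by simp [state]⟩
    | succ m ih =>
      obtain ⟨K, hK⟩ := ih
      obtain ⟨k, hk, hne⟩ := hb K
      refine ⟨k + 1, ?_⟩
      have hkK : (state b k).2 ≤ (state b K).2 := radius_antitone b hk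
      rcases state_succ_eq_or b k with h | ⟨-, h⟩
      · exact absurd h hne
      · rw [h, pow_succ]
        dsimp only
        linarith
  have hpow : Tendsto (fun m : ℕ => 4 * (1 / 2 : ℝ) ^ m) atTop (𝓝 0) := by
    simpa using (tendsto_pow_atTop_nhds_zero_of_lt_one (r := (1 / 2 : ℝ)) (by norm_num)
      (by norm_num)).const_mul 4
  rw [Metric.tendsto_atTop]
  intro ε hε
  obtain ⟨m, hm⟩ := (hpow.eventually_lt_const hε).exists
  obtain ⟨K, hK⟩ := hex m
  refine ⟨K, fun k hk => ?_⟩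
  have hkK : (state b k).2 ≤ (state b K).2 := radius_antitone b hk
  rw [Real.dist_0_eq_abs, abs_of_pos (radius_pos b k)]
  linarith

lemma isPeano_iInter_tube (b : ℕ → Bool) :
    IsPeano (⋂ k, tube (state b k).1 (state b k).2) := by
  by_cases hb : ∀ K, ∃ k ≥ K, state b (k + 1) ≠ state b k
  · have hr := tendsto_radius hb
    obtain ⟨f, hf⟩ := exists_isNear_limit (fun k => (radius_pos b k).le) (isNear_state_succ b) hr
    exact ⟨fun t n => f n t, by fun_prop, (iInter_tube_eq_range hf hr).symm⟩
  · push Not at hb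
    obtain ⟨K, hK⟩ := hb
    have hconst : ∀ k ≥ K, state b k = state b K := fun k hk => by
      induction k, hk using Nat.le_induction with
      | base => rfl
      | succ k hk ih => rw [hK k hk, ih]
    have hinter : ⋂ k, tube (state b k).1 (state b k).2 = tube (state b K).1 (state b K).2 := by
      refine (Set.iInter_subset _ K).antisymm (Set.subset_iInter fun k => ?_)
      rcases le_total k K with h | h
      · exact tube_subset_tube
          (isNear_of_le (φ := fun k => (state b k).1) (isNear_state_succ b) h)
      · rw [hconst k h]
    rw [hinter]
    exact isPeano_tube _ (radius_pos b K)

lemma isLocallyConstant_state (k : ℕ) : IsLocallyConstant fun b => state b k := by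
  induction k with
  | zero => exact IsLocallyConstant.const _
  | succ k ih =>
    have hbit : IsLocallyConstant fun b : ℕ → Bool => b k :=
      (IsLocallyConstant.iff_continuous _).2 (continuous_apply k)
    exact ih.comp₂ hbit (step (candidate k))

lemma isClosed_setOf_mem_tube (k : ℕ) :
    IsClosed {p : (ℕ → I) × (ℕ → Bool) | p.1 ∈ tube (state p.2 k).1 (state p.2 k).2} := by
  rw [← isOpen_compl_iff, isOpen_iff_mem_nhds]
  rintro ⟨x, b⟩ hx
  have h1 : (tube (state b k).1 (state b k).2)ᶜ ∈ 𝓝 x :=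
    (isClosed_of_isPeano (isPeano_tube _ (radius_pos b k))).isOpen_compl.mem_nhds hx
  have h2 : ∀ᶠ c in 𝓝 b, state c k = state b k :=
    (isLocallyConstant_state k).eventually_eq b
  filter_upwards [prod_mem_nhds h1 h2]
  rintro ⟨y, c⟩ ⟨hy, hc⟩
  have hc' : state c k = state b k := hc
  simpa [hc'] using hy

open Classical in
/-- The states obtained by accepting exactly the candidates that approximate `f` well. -/
noncomputable def greedyState (f : Path) : ℕ → Path × ℝ
  | 0 => (candidate 0, 4)
  | k + 1 => step (candidate k) (greedyState f k)
      (decide (IsNear (candidate k) f ((greedyState f k).2 / 8)))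

/-- Every path is the limit of the states along some branch. -/
lemma exists_branch (f : Path) : ∃ b : ℕ → Bool,
    (∀ k, IsNear (state b k).1 f (state b k).2) ∧
      Tendsto (fun k => (state b k).2) atTop (𝓝 0) := by
  classical
  let b : ℕ → Bool := fun k => decide (IsNear (candidate k) f ((greedyState f k).2 / 8))
  have hgreedy : ∀ k, greedyState f k = state b k := fun k => by
    induction k with
    | zero => rfl
    | succ k ih => rw [greedyState, state, ← ih]
  have hbit : ∀ k, b k = true ↔ IsNear (candidate k) f ((state b k).2 / 8) := fun k => by
    simp only [b, decide_eq_true_eq]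
    rw [hgreedy]
  have hnear : ∀ k, IsNear (state b k).1 f ((state b k).2 / 4) := fun k => by
    induction k with
    | zero => exact isNear_of_one_le _ _ (by norm_num [state])
    | succ k ih =>
      rw [state, step]
      split_ifs with h
      · exact ((hbit k).1 h.1).mono (by dsimp only; linarith)
      · exact ih
  refine ⟨b, fun k => (hnear k).mono (by linarith [radius_pos b k]), tendsto_radius fun K => ?_⟩
  by_contra! hK
  have hconst : ∀ k ≥ K, state b k = state b K := fun k hk => by
    induction k, hk using Nat.le_induction with
    | base => rfl
    | succ k hk ih => rw [hK k hk, ih]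
  have hpos := radius_pos b K
  obtain ⟨m, hm⟩ := (TopologicalSpace.denseRange_denseSeq Path).exists_mem_open
    isOpen_interior ⟨f, mem_interior_iff_mem_nhds.2
      (setOf_isNear_mem_nhds f (show 0 < (state b K).2 / 8 by positivity))⟩
  have hcand : IsNear (candidate (Nat.pair m K)) f ((state b K).2 / 8) := by
    rw [candidate, Nat.unpair_pair]
    exact interior_subset hm
  have hle : K ≤ Nat.pair m K := Nat.right_le_pair m K
  have hstate := hconst _ hle
  have hsucc := hK _ hle
  have hacc : b (Nat.pair m K) = true ∧ IsNear (state b (Nat.pair m K)).1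
      (candidate (Nat.pair m K)) ((state b (Nat.pair m K)).2 / 2) := by
    refine ⟨(hbit _).2 (by rwa [hstate]), ?_⟩
    rw [hstate]
    exact ((hnear K).trans hcand.symm).mono (by linarith)
  rw [state, step, if_pos hacc] at hsucc
  have := congrArg Prod.snd hsucc
  dsimp only at this
  linarith [radius_pos b (Nat.pair m K)]

end PeanoTube


/-- The class of all Peano continua is compactifiable: there is a closed subset `F` of
`Q × 2^ℕ` (Hilbert cube times Cantor space) all of whose sections are Peano continua,
such that every Peano continuum in `Q` is homeomorphic to some section of `F`. -/
theorem peano_continua_compactifiable :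
    ∃ F : Set ((ℕ → unitInterval) × (ℕ → Bool)), IsClosed F ∧
      (∀ b : ℕ → Bool, IsPeano {x : ℕ → unitInterval | (x, b) ∈ F}) ∧
      (∀ S : Set (ℕ → unitInterval), IsPeano S →
        ∃ b : ℕ → Bool, Nonempty (↥S ≃ₜ ↥{x : ℕ → unitInterval | (x, b) ∈ F})) := by
  refine ⟨⋂ k, {p | p.1 ∈ PeanoTube.tube (PeanoTube.state p.2 k).1 (PeanoTube.state p.2 k).2},
    isClosed_iInter PeanoTube.isClosed_setOf_mem_tube, fun b => ?_, ?_⟩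
  · convert PeanoTube.isPeano_iInter_tube b using 1
    ext x
    simp
  · rintro S ⟨f, hf, rfl⟩
    let φ : PeanoTube.Path := fun n => ⟨fun t => f t n, (continuous_apply n).comp hf⟩
    obtain ⟨b, hb, hr⟩ := PeanoTube.exists_branch φ
    refine ⟨b, ⟨Homeomorph.setCongr ?_⟩⟩
    have hrange := PeanoTube.iInter_tube_eq_range hb hr
    ext x
    rw [show Set.range f = Set.range fun t n => φ n t from rfl, ← hrange]
    simp
end

section
/- Let S¹ denote the unit circle and for each n ∈ ℕ let f_n : S¹ → S¹ be a continuous surjection. Let X_∞ = {x ∈ (S¹)^ℕ : f_n(x_{n+1}) = x_n for all n ∈ ℕ} be the inverse limit of the inverse sequence of circles, with the subspace topology of the product. If e : S¹ → X_∞ is a topological embedding, then e is surjective; equivalently, any subspace of X_∞ homeomorphic to S¹ must equal all of X_∞. Consequently, there is no universal circle-like continuum. -/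
theorem nonempty_iInter_of_antitone_isClosed {X : Type*} [TopologicalSpace X] [CompactSpace X]
    {C : ℕ → Set X} (hanti : Antitone C) (hne : ∀ n, (C n).Nonempty)
    (hclosed : ∀ n, IsClosed (C n)) : (⋂ n, C n).Nonempty :=
  IsCompact.nonempty_iInter_of_sequence_nonempty_isCompact_isClosed C
    (fun n => hanti n.le_succ) hne (hclosed 0).isCompact hclosed

/-- The one-dimensional Borsuk–Ulam theorem. -/
theorem exists_eq_neg_of_continuous_real {g : Metric.sphere (0 : ℂ) 1 → ℝ} (hg : Continuous g) :
    ∃ z, g z = g (-z) := by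
  have : PreconnectedSpace (Metric.sphere (0 : ℂ) 1) :=
    Subtype.preconnectedSpace
      (isPreconnected_sphere (by simp [Complex.rank_real_complex]) 0 1)
  have hneg : Continuous fun z => g (-z) := hg.comp continuous_neg
  let a : Metric.sphere (0 : ℂ) 1 := ⟨1, by simp⟩
  rcases le_total (g a) (g (-a)) with h | h
  · exact intermediate_value_univ₂ (a := a) (b := -a) hg hneg h (by simpa using h)
  · exact intermediate_value_univ₂ (a := -a) (b := a) hg hneg (by simpa using h) h

/-- A self-map of the circle that misses a point identifies a pair of antipodal points. -/
theorem exists_eq_neg_of_not_surjective {h : Metric.sphere (0 : ℂ) 1 → Metric.sphere (0 : ℂ) 1}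
    (hh : Continuous h) (hns : ¬ Function.Surjective h) : ∃ z, h z = h (-z) := by
  simp only [Function.Surjective, not_forall, not_exists] at hns
  obtain ⟨w, hw⟩ := hns
  have hw0 : (w : ℂ) ≠ 0 := ne_zero_of_mem_unit_sphere w
  have hnorm : ∀ z, ‖-(h z : ℂ) / w‖ = 1 := fun z => by simp
  have hslit : ∀ z, -(h z : ℂ) / w ∈ Complex.slitPlane := fun z => by
    refine Complex.mem_slitPlane_iff_arg.2 ⟨fun harg => hw z (Subtype.ext ?_), fun h0 => ?_⟩
    · have hdiv : -(h z : ℂ) / w = -1 :=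
        Complex.ext_norm_arg (by rw [hnorm]; simp) (by rw [harg, Complex.arg_neg_one])
      rw [div_eq_iff hw0] at hdiv
      simpa using hdiv
    · simpa [h0] using hnorm z
  have hcont : Continuous fun z => -(h z : ℂ) / w :=
    (continuous_subtype_val.comp hh).neg.div_const _
  obtain ⟨z, hz⟩ := exists_eq_neg_of_continuous_real
    (g := fun z => Complex.arg (-(h z : ℂ) / w))
    (continuous_iff_continuousAt.2 fun z =>
      ContinuousAt.comp (f := fun z => -(h z : ℂ) / w) (Complex.continuousAt_arg (hslit z))
        hcont.continuousAt)
  refine ⟨z, Subtype.ext ?_⟩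
  have heq : -(h z : ℂ) / w = -(h (-z) : ℂ) / w :=
    Complex.ext_norm_arg (by rw [hnorm, hnorm]) hz
  exact neg_injective ((div_left_inj' hw0).1 heq)

/-- If `X∞` is the inverse limit of an inverse sequence of unit circles with continuous
surjective bonding maps, then every topological embedding of the circle into `X∞` is
surjective: a copy of `S¹` inside `X∞` must be all of `X∞`. (Consequently there is no
universal circle-like continuum.) -/
theorem circle_embedding_into_inverse_limit_of_circles_is_surjective
    (f : ∀ _ : ℕ, ↥(Metric.sphere (0 : ℂ) 1) → ↥(Metric.sphere (0 : ℂ) 1))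
    (hfc : ∀ n, Continuous (f n)) (hfs : ∀ n, Function.Surjective (f n))
    (e : ↥(Metric.sphere (0 : ℂ) 1) →
      ↥{x : ℕ → ↥(Metric.sphere (0 : ℂ) 1) | ∀ n : ℕ, f n (x (n + 1)) = x n})
    (he : Topology.IsEmbedding e) :
    Function.Surjective e := by
  let p : ℕ → Metric.sphere (0 : ℂ) 1 → Metric.sphere (0 : ℂ) 1 := fun n z => (e z).1 n
  have hp : ∀ n, Continuous (p n) := fun n =>
    (continuous_apply n).comp (continuous_subtype_val.comp he.continuous)
  have hstep : ∀ n z, f n (p (n + 1) z) = p n z := fun n z => (e z).2 n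
  have hagree : Antitone fun n => {z | p n z = p n (-z)} :=
    antitone_nat_of_succ_le fun n z (hz : p (n + 1) z = p (n + 1) (-z)) => by
      change p n z = p n (-z)
      rw [← hstep n z, ← hstep n (-z), hz]
  obtain ⟨N, hN⟩ : ∃ N, ¬ {z | p N z = p N (-z)}.Nonempty := by
    by_contra! h
    obtain ⟨z, hz⟩ := nonempty_iInter_of_antitone_isClosed hagree h fun n =>
      isClosed_eq (hp n) ((hp n).comp continuous_neg)
    have hzneg : e z = e (-z) := Subtype.ext (funext fun n => Set.mem_iInter.1 hz n)
    exact ne_neg_of_mem_unit_sphere ℝ z (he.injective hzneg)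
  have hsurj : ∀ m, N ≤ m → Function.Surjective (p m) := fun m hm => by
    by_contra h
    exact hN ((exists_eq_neg_of_not_surjective (hp m) h).imp fun z hz => hagree hm hz)
  intro y
  have hfiber : Antitone fun n => {z | p n z = y.1 n} :=
    antitone_nat_of_succ_le fun n z (hz : p (n + 1) z = y.1 (n + 1)) => by
      change p n z = y.1 n
      rw [← hstep, hz, y.2 n]
  obtain ⟨z, hz⟩ := nonempty_iInter_of_antitone_isClosed hfiber
    (fun n => (hsurj (max N n) (le_max_left N n) (y.1 (max N n))).imp fun z hz =>
      hfiber (le_max_right N n) hz)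
    fun n => isClosed_eq (hp n) continuous_const
  exact ⟨z, Subtype.ext (funext fun n => Set.mem_iInter.1 hz n)⟩
end
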